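/- arXiv:math/0411026 — 3 statements merged into one kernel-verified Lean document; each statement's English description precedes it below -/
import Mathlib

section
/- Let A' and A'' be antichains in P with A' ≤ A'' in 𝔄_▽(P) (i.e., 𝔉(A') ⊆ 𝔉(A'')), let ω be a weight map, and let r be a rational with 0 ≤ r < 1. Then I_r(P,A';ω) ⊇ I_r(P,A'';ω). -/
open scoped Classical

variable {α : Type*}

/-- The order ideal generated by a subset `S` of a poset. -/
def idl [PartialOrder α] (S : Set α) : Set α := {p | ∃ s ∈ S, p ≤ s}

/-- The order filter generated by a subset `S` of a poset. -/
def filt [PartialOrder α] (S : Set α) : Set α := {p | ∃ s ∈ S, s ≤ p}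

/-- The set of maximal elements of a subposet. -/
def maxOf [PartialOrder α] (S : Set α) : Set α := {x | x ∈ S ∧ ∀ y ∈ S, x ≤ y → x = y}

/-- The set of minimal elements of a subposet. -/
def minOf [PartialOrder α] (S : Set α) : Set α := {x | x ∈ S ∧ ∀ y ∈ S, y ≤ x → x = y}

/-- The meet `A ∧_▵ B := max (𝔍(A) ∩ 𝔍(B))` of antichains in `𝔄_▵(P)`. -/
def meetT [PartialOrder α] (A B : Set α) : Set α := maxOf (idl A ∩ idl B)

/-- A weight map `ω` on antichains of `P`: `ω(∅) = -1`, `ω({⊥}) = 0`, and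
`0 < ω(A') ≤ ω(A'')` whenever `{⊥} < A' ≤ A''` in `𝔄_▵(P)`. -/
structure WeightMap (α : Type*) [PartialOrder α] [OrderBot α] where
  w : Set α → ℤ
  w_empty : w (∅ : Set α) = -1
  w_bot : w ({⊥} : Set α) = 0
  w_pos_mono : ∀ A' A'' : Set α, IsAntichain (· ≤ ·) A' → IsAntichain (· ≤ ·) A'' →
    idl ({⊥} : Set α) ⊂ idl A' → idl A' ⊆ idl A'' → 0 < w A' ∧ w A' ≤ w A''

/-- The subposet `I_r(P,A;ω)` of relatively `r`-blocking elements for `A` in `P`. -/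
noncomputable def relBlock [PartialOrder α] [OrderBot α] (ω : WeightMap α) (r : ℚ)
    (A : Set α) : Set α :=
  if A = ∅ then Set.univ
  else if A = ({⊥} : Set α) then ∅
  else {b | b ≠ ⊥ ∧ ∀ a ∈ A \ {⊥}, r < (ω.w (meetT {b} {a}) : ℚ) / (ω.w {b} : ℚ)}

theorem idl_maxOf [PartialOrder α] [Finite α] {S : Set α}
    (hS : ∀ x ∈ S, ∀ y, y ≤ x → y ∈ S) : idl (maxOf S) = S := by
  ext p
  constructor
  · rintro ⟨s, hs, hps⟩
    exact hS s hs.1 p hps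
  · intro hp
    obtain ⟨m, hpm, hm⟩ := (Set.toFinite S).exists_le_maximal hp
    exact ⟨m, ⟨hm.1, fun y hy hmy => hm.eq_of_le hy hmy⟩, hpm⟩

theorem isAntichain_maxOf [PartialOrder α] (S : Set α) : IsAntichain (· ≤ ·) (maxOf S) :=
  fun _ hx _ hy hne hle => hne (hx.2 _ hy.1 hle)

theorem idl_meetT [PartialOrder α] [Finite α] (A B : Set α) :
    idl (meetT A B) = idl A ∩ idl B :=
  idl_maxOf fun _ ⟨⟨a, ha, hxa⟩, ⟨b, hb, hxb⟩⟩ _ hyx =>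
    ⟨⟨a, ha, hyx.trans hxa⟩, ⟨b, hb, hyx.trans hxb⟩⟩

theorem bot_mem_idl_singleton [PartialOrder α] [OrderBot α] (a : α) : ⊥ ∈ idl {a} :=
  ⟨a, rfl, bot_le⟩

theorem idl_singleton_mono [PartialOrder α] {a b : α} (h : a ≤ b) : idl {a} ⊆ idl {b} := by
  rintro p ⟨s, rfl, hp⟩
  exact ⟨b, rfl, hp.trans h⟩

theorem idl_bot [PartialOrder α] [OrderBot α] : idl {(⊥ : α)} = {⊥} := by
  ext p
  simp [idl]

theorem meetT_eq_bot [PartialOrder α] [OrderBot α] {A B : Set α}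
    (h : idl A ∩ idl B = {⊥}) : meetT A B = {⊥} := by
  ext p
  simp [meetT, h, maxOf]

theorem WeightMap.w_singleton_pos [PartialOrder α] [OrderBot α] (ω : WeightMap α) {b : α}
    (hb : b ≠ ⊥) : 0 < ω.w {b} := by
  have hanti : IsAntichain (· ≤ ·) ({b} : Set α) := Set.subsingleton_singleton.isAntichain _
  refine (ω.w_pos_mono {b} {b} hanti hanti ⟨idl_singleton_mono bot_le, fun h => ?_⟩ le_rfl).1
  rw [idl_bot] at h
  exact hb (h ⟨b, rfl, le_rfl⟩)

/-- The weight of `{b} ∧_▵ {a}` is monotone in `a` as soon as it is positive. -/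
theorem WeightMap.w_meetT_le [PartialOrder α] [OrderBot α] [Finite α] (ω : WeightMap α)
    {a a' b : α} (haa' : a ≤ a') (hpos : 0 < ω.w (meetT {b} {a})) :
    ω.w (meetT {b} {a}) ≤ ω.w (meetT {b} {a'}) := by
  have hbot : ({⊥} : Set α) ⊆ idl {b} ∩ idl {a} :=
    Set.singleton_subset_iff.2 ⟨bot_mem_idl_singleton b, bot_mem_idl_singleton a⟩
  refine (ω.w_pos_mono _ _ (isAntichain_maxOf _) (isAntichain_maxOf _) ?_ ?_).2
  · change idl {⊥} ⊂ idl (meetT {b} {a})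
    rw [idl_meetT, idl_bot]
    refine hbot.ssubset_of_ne fun h => ?_
    rw [meetT_eq_bot h.symm, ω.w_bot] at hpos
    exact hpos.false
  · change idl (meetT {b} {a}) ⊆ idl (meetT {b} {a'})
    rw [idl_meetT, idl_meetT]
    exact Set.inter_subset_inter_right _ (idl_singleton_mono haa')

theorem eq_singleton_bot_of_bot_mem [PartialOrder α] [OrderBot α] {A : Set α}
    (hA : IsAntichain (· ≤ ·) A) (h : ⊥ ∈ A) : A = {⊥} :=
  Set.eq_singleton_iff_unique_mem.2 ⟨h, fun _ hx => (hA.eq h hx bot_le).symm⟩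

/-- If `A' ≤ A''` in `𝔄_▽(P)` then `I_r(P,A';ω) ⊇ I_r(P,A'';ω)`. -/
theorem stmt_1 [Fintype α] [PartialOrder α] [BoundedOrder α] [Nontrivial α]
    (ω : WeightMap α) (r : ℚ) (hr0 : 0 ≤ r) (hr1 : r < 1)
    (A' A'' : Set α) (hA' : IsAntichain (· ≤ ·) A') (hA'' : IsAntichain (· ≤ ·) A'')
    (hle : filt A' ⊆ filt A'') :
    relBlock ω r A'' ⊆ relBlock ω r A' := by
  have hbelow : ∀ a ∈ A', ∃ c ∈ A'', c ≤ a := fun a ha => hle ⟨a, ha, le_rfl⟩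
  intro b hb
  by_cases h1 : A' = ∅
  · simp [relBlock, h1]
  have h2 : A'' ≠ ∅ := by
    rintro rfl
    obtain ⟨a, ha⟩ := Set.nonempty_iff_ne_empty.2 h1
    obtain ⟨c, hc, -⟩ := hbelow a ha
    exact hc
  have h3 : A'' ≠ {⊥} := by
    rintro rfl
    simp [relBlock] at hb
  have hbot : ⊥ ∉ A'' := fun h => h3 (eq_singleton_bot_of_bot_mem hA'' h)
  have h4 : A' ≠ {⊥} := by
    rintro rfl
    obtain ⟨c, hc, hc'⟩ := hbelow ⊥ rfl
    exact hbot (le_bot_iff.1 hc' ▸ hc)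
  rw [relBlock, if_neg h2, if_neg h3] at hb
  rw [relBlock, if_neg h1, if_neg h4]
  refine ⟨hb.1, fun a ha => ?_⟩
  obtain ⟨c, hc, hca⟩ := hbelow a ha.1
  have hlt := hb.2 c ⟨hc, fun h => hbot (h ▸ hc)⟩
  have hwb : (0 : ℚ) < ω.w {b} := by exact_mod_cast ω.w_singleton_pos hb.1
  have hpos : 0 < ω.w (meetT {b} {c}) := by
    exact_mod_cast (div_pos_iff_of_pos_right hwb).1 (hr0.trans_lt hlt)
  refine hlt.trans_le ?_
  gcongr
  exact ω.w_meetT_le hca hpos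
end

section
/- Let P be a finite bounded graded poset with rank function ρ, let A be a nontrivial antichain in P, and let r be a rational with 0 ≤ r < 1. Then I_r(P,A;ρ) = ⋃ { P^{(k)} ∩ 𝔉(b_{ν(r·k)−1}(A)) : k an integer with 1 ≤ k ≤ ρ(P) and ν(r·k) ≤ min_{a∈A} ρ(a) }, where b_j denotes the absolute j-blocker map with respect to the weight map ρ. -/
open scoped Classical

variable {α : Type*}

/-- The weight map induced on antichains by the rank function `ρ`:
`A ↦ max_{a ∈ A} ρ(a)` for `A ≠ ∅`, and `∅ ↦ -1`. -/
noncomputable def wr [PartialOrder α] (ρ : α → ℕ) (A : Set α) : ℤ :=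
  if A = ∅ then -1 else sSup ((fun a => (ρ a : ℤ)) '' A)

/-- `ν(x) = ⌈x⌉` if the rational `x` is not an integer, and `ν(x) = x + 1` if it is. -/
def nu (x : ℚ) : ℤ := if x.den = 1 then x.num + 1 else ⌈x⌉

/-- The subposet `I_r(P,A;ρ)` of relatively `r`-blocking elements for a nontrivial `A`. -/
noncomputable def relBlockR [PartialOrder α] [OrderBot α] (ρ : α → ℕ) (r : ℚ)
    (A : Set α) : Set α :=
  {b | b ≠ ⊥ ∧ ∀ a ∈ A \ {⊥}, r < (wr ρ (meetT {b} {a}) : ℚ) / (wr ρ {b} : ℚ)}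

/-- The absolute `j`-blocker `b_j(A) = min {b ∈ P : ρ({b} ∧_▵ {a}) > j for all a ∈ A}`
of a nontrivial antichain `A`, w.r.t. the weight map `ρ`. -/
noncomputable def bjR [PartialOrder α] (ρ : α → ℕ) (j : ℤ) (A : Set α) : Set α :=
  minOf {b | ∀ a ∈ A, j < wr ρ (meetT {b} {a})}

theorem lt_iff_nu_le (x : ℚ) (m : ℤ) : x < (m : ℚ) ↔ nu x ≤ m := by
  unfold nu
  split_ifs with h
  · have hx : ((x.num : ℤ) : ℚ) = x := (Rat.den_eq_one_iff x).mp h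
    rw [← hx, Int.cast_lt, Rat.num_intCast, Int.add_one_le_iff]
  · rw [Int.ceil_le]
    refine ⟨le_of_lt, fun hle => lt_of_le_of_ne hle ?_⟩
    rintro rfl
    exact h (Rat.den_intCast m)

theorem strictMono_of_covBy_add_one [Finite α] [PartialOrder α] (ρ : α → ℕ)
    (hgraded : ∀ x y : α, x ⋖ y → ρ y = ρ x + 1) : StrictMono ρ := by
  have := Fintype.ofFinite α
  have : LocallyFiniteOrder α := Fintype.toLocallyFiniteOrder
  rw [strictMono_iff_forall_covBy]
  intro x y h
  rw [hgraded x y h]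
  exact Nat.lt_succ_self _

theorem lt_wr_iff [Finite α] [PartialOrder α] (ρ : α → ℕ) {S : Set α} (hS : S.Nonempty) (j : ℤ) :
    j < wr ρ S ↔ ∃ c ∈ S, j < (ρ c : ℤ) := by
  rw [wr, if_neg hS.ne_empty, lt_csSup_iff (Set.toFinite _).bddAbove (hS.image _)]
  simp

theorem wr_singleton [PartialOrder α] (ρ : α → ℕ) (b : α) : wr ρ {b} = ρ b := by
  simp [wr]

theorem exists_le_mem_maxOf [Finite α] [PartialOrder α] {S : Set α} {c : α} (hc : c ∈ S) :
    ∃ d ∈ maxOf S, c ≤ d := by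
  obtain ⟨d, hcd, hd⟩ := (Set.toFinite S).exists_le_maximal hc
  exact ⟨d, ⟨hd.prop, fun y hy h => hd.eq_of_le hy h⟩, hcd⟩

theorem exists_mem_minOf_le [Finite α] [PartialOrder α] {S : Set α} {c : α} (hc : c ∈ S) :
    ∃ d ∈ minOf S, d ≤ c := by
  obtain ⟨d, hdc, hd⟩ := (Set.toFinite S).exists_le_minimal hc
  exact ⟨d, ⟨hd.prop, fun y hy h => hd.eq_of_ge hy h⟩, hdc⟩

theorem filt_minOf_of_isUpperSet [Finite α] [PartialOrder α] {S : Set α} (hS : IsUpperSet S) :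
    filt (minOf S) = S := by
  ext b
  exact ⟨fun ⟨_, hs, hsb⟩ => hS hsb hs.1, fun hb => exists_mem_minOf_le hb⟩

theorem lt_wr_meetT_iff [Finite α] [PartialOrder α] [OrderBot α] {ρ : α → ℕ} (hρ : Monotone ρ)
    (a b : α) (j : ℤ) :
    j < wr ρ (meetT {b} {a}) ↔ ∃ c, c ≤ b ∧ c ≤ a ∧ j < (ρ c : ℤ) := by
  have hbot : (⊥ : α) ∈ idl {b} ∩ idl {a} := ⟨⟨b, rfl, bot_le⟩, ⟨a, rfl, bot_le⟩⟩
  obtain ⟨d, hd, -⟩ := exists_le_mem_maxOf hbot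
  rw [meetT, lt_wr_iff ρ ⟨d, hd⟩]
  constructor
  · rintro ⟨c, ⟨⟨⟨_, rfl, hcb⟩, ⟨_, rfl, hca⟩⟩, -⟩, hc⟩
    exact ⟨c, hcb, hca, hc⟩
  · rintro ⟨c, hcb, hca, hc⟩
    obtain ⟨e, he, hce⟩ := exists_le_mem_maxOf (S := idl {b} ∩ idl {a})
      ⟨⟨b, rfl, hcb⟩, ⟨a, rfl, hca⟩⟩
    exact ⟨e, he, hc.trans_le (by exact_mod_cast hρ hce)⟩

theorem filt_bjR [Finite α] [PartialOrder α] [OrderBot α] {ρ : α → ℕ} (hρ : Monotone ρ)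
    (j : ℤ) (A : Set α) :
    filt (bjR ρ j A) = {b | ∀ a ∈ A, j < wr ρ (meetT {b} {a})} := by
  refine filt_minOf_of_isUpperSet fun b b' hbb' hb a ha => ?_
  obtain ⟨c, hcb, hca, hc⟩ := (lt_wr_meetT_iff hρ a b j).mp (hb a ha)
  exact (lt_wr_meetT_iff hρ a b' j).mpr ⟨c, hcb.trans hbb', hca, hc⟩

/-- In a graded poset, `I_r(P,A;ρ)` is the union, over integers `k` with `1 ≤ k ≤ ρ(P)` and
`ν(r·k) ≤ min_{a ∈ A} ρ(a)`, of the sets `P^{(k)} ∩ 𝔉(b_{ν(r·k)-1}(A))`. -/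
theorem stmt_9 [Fintype α] [PartialOrder α] [BoundedOrder α] [Nontrivial α]
    (ρ : α → ℕ) (hρbot : ρ ⊥ = 0) (hgraded : ∀ x y : α, x ⋖ y → ρ y = ρ x + 1)
    (A : Set α) (hA : IsAntichain (· ≤ ·) A) (hne : A ≠ ∅) (hnt : A ≠ ({⊥} : Set α))
    (r : ℚ) (hr0 : 0 ≤ r) (hr1 : r < 1) :
    relBlockR ρ r A =
      ⋃ k ∈ {k : ℕ | 1 ≤ k ∧ k ≤ ρ ⊤ ∧ nu (r * (k : ℚ)) ≤ sInf ((fun a => (ρ a : ℤ)) '' A)},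
        ({p : α | ρ p = k} ∩ filt (bjR ρ (nu (r * (k : ℚ)) - 1) A)) := by
  have hρ := strictMono_of_covBy_add_one ρ hgraded
  have hpos : ∀ b : α, b ≠ ⊥ ↔ 1 ≤ ρ b := fun b =>
    ⟨fun hb => Nat.one_le_of_lt (hρ (bot_lt_iff_ne_bot.mpr hb)), by rintro h rfl; omega⟩
  have hbot : ⊥ ∉ A := fun h => hnt (hA.bot_mem_iff.mp h)
  ext b
  simp only [relBlockR, Set.sdiff_singleton_eq_self hbot, filt_bjR hρ.monotone, wr_singleton,
    Set.mem_ofPred_eq, Set.mem_iUnion, Set.mem_inter_iff, exists_prop, hpos b]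
  have key : 1 ≤ ρ b → ∀ a, r < (wr ρ (meetT {b} {a}) : ℚ) / ((ρ b : ℤ) : ℚ) ↔
      nu (r * ρ b) - 1 < wr ρ (meetT {b} {a}) := fun hb a => by
    rw [Int.cast_natCast, lt_div_iff₀ (by exact_mod_cast hb), lt_iff_nu_le, Int.sub_one_lt_iff]
  constructor
  · rintro ⟨hb, h⟩
    have h' : ∀ a ∈ A, nu (r * ρ b) - 1 < wr ρ (meetT {b} {a}) := fun a ha =>
      (key hb a).mp (h a ha)
    refine ⟨ρ b, ⟨hb, hρ.monotone le_top, ?_⟩, rfl, h'⟩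
    refine le_csInf ((Set.nonempty_iff_ne_empty.mpr hne).image _) ?_
    rintro _ ⟨a, ha, rfl⟩
    obtain ⟨c, -, hca, hc⟩ := (lt_wr_meetT_iff hρ.monotone a b _).mp (h' a ha)
    have := hρ.monotone hca
    dsimp only
    omega
  · rintro ⟨_, ⟨hb, -, -⟩, rfl, h⟩
    exact ⟨hb, fun a ha => (key hb a).mpr (h a ha)⟩
end

section
/- Let P be a finite bounded graded poset with rank function ρ, let A be a nontrivial antichain in P, and let r be a rational with 0 ≤ r < 1. Then I_r(P,A;ρ) = ( ⋂_{a∈A} 𝔍(a) ∖ {0̂} ) ∪ ⋃_{k ∈ D_r(P,A;ρ)} ( P^{(k)} ∩ 𝔉(b_{ν(r·k)−1}(A)) ), where b_j denotes the absolute j-blocker map with respect to the weight map ρ. -/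
open scoped Classical

variable {α : Type*}

/-- The Farey subsequence `F(P,a;ρ)`: the set of rationals consisting of `0` and `1`
together with all fractions `ρ({b} ∧_▵ {a}) / ρ(b)` for `b ∈ P ∖ {⊥}`. -/
noncomputable def Fsub [PartialOrder α] [OrderBot α] (ρ : α → ℕ) (a : α) : Set ℚ :=
  {0, 1} ∪ {q | ∃ b : α, b ≠ ⊥ ∧ q = (wr ρ (meetT {b} {a}) : ℚ) / (wr ρ {b} : ℚ)}

/-- `fmax F r = max {f ∈ F : f ≤ r}` (when such a maximum exists). -/
noncomputable def fmax (F : Set ℚ) (r : ℚ) : ℚ :=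
  if h : ∃ q, q ∈ F ∧ q ≤ r ∧ ∀ f ∈ F, f ≤ r → f ≤ q then h.choose else 0

/-- The set of positive integers `D_r(P,A;ρ)`. -/
noncomputable def Dr [PartialOrder α] [BoundedOrder α] (ρ : α → ℕ) (r : ℚ)
    (A : Set α) : Set ℤ :=
  ⋂ a ∈ A,
    ((⋃ f ∈ {f : ℚ | f ∈ Fsub ρ a ∧ fmax (Fsub ρ a) r < f ∧ f < 1},
        {d : ℤ | ∃ s : ℤ, 1 ≤ s ∧
          s ≤ min ((ρ a : ℤ) / f.num) ((ρ (⊤ : α) : ℤ) / (f.den : ℤ)) ∧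
          d = s * (f.den : ℤ)})
      ∪ {d : ℤ | ∃ e ∈ idl {a}, e ≠ ⊥ ∧ d = (ρ e : ℤ)})

theorem isGreatest_wr [Finite α] [PartialOrder α] (ρ : α → ℕ) {S : Set α} (hS : S.Nonempty) :
    IsGreatest ((fun a => (ρ a : ℤ)) '' S) (wr ρ S) := by
  have hfin : ((fun a => (ρ a : ℤ)) '' S).Finite := (Set.toFinite S).image _
  rw [wr, if_neg hS.ne_empty]
  exact ⟨(hS.image _).csSup_mem hfin, fun x hx => le_csSup hfin.bddAbove hx⟩

theorem mem_idl_singleton [PartialOrder α] {a b : α} : b ∈ idl {a} ↔ b ≤ a := by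
  simp [idl]

/-- The weight of `{b} ∧_▵ {a}` is the largest value of a monotone `ρ` on the common lower bounds
of `a` and `b`. -/
theorem isGreatest_wr_meetT [Finite α] [PartialOrder α] [OrderBot α] {ρ : α → ℕ}
    (hρ : Monotone ρ) (a b : α) :
    IsGreatest ((fun e => (ρ e : ℤ)) '' {e | e ≤ b ∧ e ≤ a}) (wr ρ (meetT {b} {a})) := by
  have key : ∀ e, e ≤ b → e ≤ a → ∃ e' ∈ meetT {b} {a}, e ≤ e' := by
    intro e hb ha
    obtain ⟨m, hem, hm⟩ := (Set.toFinite (idl {b} ∩ idl {a})).exists_le_maximal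
      ⟨mem_idl_singleton.2 hb, mem_idl_singleton.2 ha⟩
    exact ⟨m, ⟨hm.prop, fun y hy hmy => hm.eq_of_le hy hmy⟩, hem⟩
  have hne : (meetT {b} {a}).Nonempty := by
    obtain ⟨e, he, -⟩ := key ⊥ bot_le bot_le
    exact ⟨e, he⟩
  have hw := isGreatest_wr ρ hne
  constructor
  · obtain ⟨e, he, hew⟩ := hw.1
    exact ⟨e, ⟨mem_idl_singleton.1 he.1.1, mem_idl_singleton.1 he.1.2⟩, hew⟩
  · rintro _ ⟨e, ⟨hb, ha⟩, rfl⟩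
    obtain ⟨e', he', hle⟩ := key e hb ha
    exact (Int.ofNat_le.2 (hρ hle)).trans (hw.2 ⟨e', he', rfl⟩)

theorem wr_meetT_mono [Finite α] [PartialOrder α] [OrderBot α] {ρ : α → ℕ}
    (hρ : Monotone ρ) (a : α) {b c : α} (h : b ≤ c) :
    wr ρ (meetT {b} {a}) ≤ wr ρ (meetT {c} {a}) := by
  obtain ⟨e, ⟨hb, ha⟩, hew⟩ := (isGreatest_wr_meetT hρ a b).1
  rw [← hew]
  exact (isGreatest_wr_meetT hρ a c).2 ⟨e, ⟨hb.trans h, ha⟩, rfl⟩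

theorem nu_eq_floor_add_one (x : ℚ) : nu x = ⌊x⌋ + 1 := by
  unfold nu
  split_ifs with h
  · rw [← Rat.coe_int_num_of_den_eq_one h]
    simp
  · refine Int.ceil_eq_iff.2 ⟨?_, ?_⟩
    · have hne : (⌊x⌋ : ℚ) ≠ x := fun he => h (by rw [← he]; simp)
      push_cast
      linarith [lt_of_le_of_ne (Int.floor_le x) hne]
    · push_cast
      exact (Int.lt_floor_add_one x).le

theorem nu_sub_one_lt_iff {x : ℚ} {m : ℤ} : nu x - 1 < m ↔ x < m := by
  rw [nu_eq_floor_add_one, add_sub_cancel_right, Int.floor_lt]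

theorem fmax_le {F : Set ℚ} {r : ℚ} (hr : 0 ≤ r) : fmax F r ≤ r := by
  unfold fmax
  split_ifs with h
  · exact h.choose_spec.2.1
  · exact hr

/-- A fraction `m / k` of integers is obtained from its lowest terms by a positive factor. -/
theorem exists_mul_num_den {m k : ℤ} (hk : 0 < k) :
    ∃ s : ℤ, 1 ≤ s ∧ m = s * ((m : ℚ) / k).num ∧ k = s * (((m : ℚ) / k).den : ℤ) := by
  obtain ⟨s, h1, h2⟩ := Rat.num_den_mk hk.ne' (Rat.divInt_eq_div m k).symm
  refine ⟨s, ?_, h1, h2⟩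
  have hden : (0 : ℤ) < (((m : ℚ) / k).den : ℤ) := by exact_mod_cast Rat.den_pos _
  by_contra! hs
  nlinarith

theorem pos_of_mem_Dr [PartialOrder α] [BoundedOrder α] {ρ : α → ℕ}
    (hpos : ∀ e : α, e ≠ ⊥ → 0 < ρ e) {r : ℚ} {A : Set α} (hA : A.Nonempty) {k : ℤ}
    (hk : k ∈ Dr ρ r A) : 0 < k := by
  obtain ⟨a, ha⟩ := hA
  rcases Set.mem_iInter₂.1 hk a ha with h | ⟨e, -, he, rfl⟩
  · obtain ⟨f, -, s, hs, -, rfl⟩ := Set.mem_iUnion₂.1 h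
    have : (0 : ℤ) < (f.den : ℤ) := by exact_mod_cast f.den_pos
    positivity
  · exact_mod_cast hpos e he

theorem mem_Dr_of_mem_relBlockR [Finite α] [PartialOrder α] [BoundedOrder α] {ρ : α → ℕ}
    (hρ : StrictMono ρ) (hpos : ∀ e : α, e ≠ ⊥ → 0 < ρ e) {r : ℚ} (hr0 : 0 ≤ r) {A : Set α}
    (hbot : ⊥ ∉ A) {b : α} (hb : b ∈ relBlockR ρ r A) : (ρ b : ℤ) ∈ Dr ρ r A := by
  obtain ⟨hb0, hbA⟩ := hb
  refine Set.mem_iInter₂.2 fun a ha => ?_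
  have hr := hbA a ⟨ha, fun h => hbot (h ▸ ha)⟩
  obtain ⟨e, ⟨heb, hea⟩, hew⟩ := (isGreatest_wr_meetT hρ.monotone a b).1
  by_cases hab : b ≤ a
  · exact Or.inr ⟨b, mem_idl_singleton.2 hab, hb0, rfl⟩
  left
  have hk : (0 : ℤ) < ρ b := by exact_mod_cast hpos b hb0
  have hkq : (0 : ℚ) < ((ρ b : ℤ) : ℚ) := by exact_mod_cast hk
  have hlt : e < b := lt_of_le_of_ne heb fun h => hab (h ▸ hea)
  have hF : (wr ρ (meetT {b} {a}) : ℚ) / (wr ρ {b} : ℚ) ∈ Fsub ρ a := Or.inr ⟨b, hb0, rfl⟩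
  rw [← hew, wr_singleton] at hr hF
  obtain ⟨s, hs, hsm, hsk⟩ := exists_mul_num_den (m := ρ e) hk
  refine Set.mem_iUnion₂.2 ⟨_, ⟨hF, (fmax_le hr0).trans_lt hr, ?_⟩, s, hs, le_min ?_ ?_, hsk⟩
  · rw [div_lt_one hkq]
    exact Int.cast_lt.2 (Int.ofNat_lt.2 (hρ hlt))
  · rw [Int.le_ediv_iff_mul_le (Rat.num_pos.2 (hr0.trans_lt hr)), ← hsm]
    exact_mod_cast hρ.monotone hea
  · rw [Int.le_ediv_iff_mul_le (by exact_mod_cast Rat.den_pos _), ← hsk]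
    exact_mod_cast hρ.monotone le_top

/-- In a graded poset, `I_r(P,A;ρ)` equals `(⋂_{a ∈ A} 𝔍(a) ∖ {⊥})` together with the union,
over `k ∈ D_r(P,A;ρ)`, of the sets `P^{(k)} ∩ 𝔉(b_{ν(r·k)-1}(A))`. -/
theorem stmt_19 [Fintype α] [PartialOrder α] [BoundedOrder α] [Nontrivial α]
    (ρ : α → ℕ) (hρbot : ρ ⊥ = 0) (hgraded : ∀ x y : α, x ⋖ y → ρ y = ρ x + 1)
    (A : Set α) (hA : IsAntichain (· ≤ ·) A) (hne : A ≠ ∅) (hnt : A ≠ ({⊥} : Set α))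
    (r : ℚ) (hr0 : 0 ≤ r) (hr1 : r < 1) :
    relBlockR ρ r A =
      ((⋂ a ∈ A, idl {a}) \ {⊥}) ∪
      ⋃ k ∈ Dr ρ r A,
        ({p : α | (ρ p : ℤ) = k} ∩ filt (bjR ρ (nu (r * (k : ℚ)) - 1) A)) := by
  let _ : LocallyFiniteOrder α := Fintype.toLocallyFiniteOrder
  have hρ : StrictMono ρ := (strictMono_iff_forall_covBy ρ).2 fun x y h => by
    rw [hgraded x y h]
    exact Nat.lt_succ_self _
  have hpos : ∀ e : α, e ≠ ⊥ → 0 < ρ e := fun e he => hρbot ▸ hρ (bot_lt_iff_ne_bot.2 he)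
  have hbot : ⊥ ∉ A := fun h => hnt <| Set.eq_singleton_iff_unique_mem.2
    ⟨h, fun x hx => (hA.eq h hx bot_le).symm⟩
  have hne' : A.Nonempty := Set.nonempty_iff_ne_empty.2 hne
  ext b
  constructor
  · intro hb
    right
    refine Set.mem_iUnion₂.2 ⟨ρ b, mem_Dr_of_mem_relBlockR hρ hpos hr0 hbot hb, rfl, ?_⟩
    have hk : (0 : ℚ) < ((ρ b : ℤ) : ℚ) := by exact_mod_cast hpos b hb.1
    obtain ⟨c, hcb, hc⟩ := (Set.toFinite
      {c | ∀ a ∈ A, nu (r * ((ρ b : ℤ) : ℚ)) - 1 < wr ρ (meetT {c} {a})}).exists_le_minimal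
      (a := b) fun a ha => by
        have h := hb.2 a ⟨ha, fun h => hbot (h ▸ ha)⟩
        rw [wr_singleton, lt_div_iff₀ hk] at h
        exact nu_sub_one_lt_iff.2 h
    exact ⟨c, ⟨hc.prop, fun y hy hyc => hc.eq_of_ge hy hyc⟩, hcb⟩
  · rintro (⟨hb, hb0⟩ | hb)
    · refine ⟨hb0, fun a ha => ?_⟩
      have hba : b ≤ a := mem_idl_singleton.1 (Set.mem_iInter₂.1 hb a ha.1)
      have hk : (0 : ℚ) < ((ρ b : ℤ) : ℚ) := by exact_mod_cast hpos b hb0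
      have hle := (isGreatest_wr_meetT hρ.monotone a b).2 ⟨b, ⟨le_rfl, hba⟩, rfl⟩
      rw [wr_singleton]
      refine hr1.trans_le ((one_le_div hk).2 ?_)
      exact_mod_cast hle
    · obtain ⟨k, hkD, rfl, c, hc, hcb⟩ := Set.mem_iUnion₂.1 hb
      have hk0 := pos_of_mem_Dr hpos hne' hkD
      have hk : (0 : ℚ) < ((ρ b : ℤ) : ℚ) := by exact_mod_cast hk0
      refine ⟨?_, fun a ha => ?_⟩
      · rintro rfl
        simp [hρbot] at hk0
      · rw [wr_singleton, lt_div_iff₀ hk]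
        exact nu_sub_one_lt_iff.1 ((hc.1 a ha.1).trans_le (wr_meetT_mono hρ.monotone a hcb))
end
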